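/- arXiv:0704.1335 — 6 statements merged into one kernel-verified Lean document; each statement's English description precedes it below -/
import Mathlib

section
/- Let a ∈ ℝ with a ≠ 0, and let g : (0,∞) → ℂ be continuous with sup_{t>0} e^{a t}·‖g(t)‖ < ∞. Then there exists a differentiable function f : (0,∞) → ℂ such that f′(t) = g(t) for all t > 0 and sup_{t>0} e^{a t}·‖f(t)‖ < ∞. (This is the vanishing H^1_{(∞)}((0,∞); w_a) = 0 for all a ≠ 0: every closed 1-form g dt in the weighted L^∞ complex is exact in that complex.) -/
open MeasureTheory in
theorem integrableOn_of_exp_weight_bound {a C : ℝ} {g : ℝ → ℂ} {s : Set ℝ}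
    (hs : MeasurableSet s) (hg : ContinuousOn g s)
    (hC : ∀ t ∈ s, ‖g t‖ ≤ C * Real.exp (-a * t))
    (hexp : IntegrableOn (fun t => Real.exp (-a * t)) s) : IntegrableOn g s :=
  (hexp.const_mul C).mono' (hg.aestronglyMeasurable hs)
    ((ae_restrict_iff' hs).2 (Filter.Eventually.of_forall hC))

theorem weighted_Linfty_H1_vanishes (a : ℝ) (ha : a ≠ 0) (g : ℝ → ℂ)
    (hg : ContinuousOn g (Set.Ioi (0 : ℝ)))
    (hgbd : ∃ C : ℝ, ∀ t ∈ Set.Ioi (0 : ℝ), Real.exp (a * t) * ‖g t‖ ≤ C) :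
    ∃ f : ℝ → ℂ,
      (∀ t ∈ Set.Ioi (0 : ℝ), HasDerivAt f (g t) t) ∧
      (∃ C : ℝ, ∀ t ∈ Set.Ioi (0 : ℝ), Real.exp (a * t) * ‖f t‖ ≤ C) := by
  obtain ⟨C, hC⟩ := hgbd
  have hexp_mul (t : ℝ) : Real.exp (a * t) * Real.exp (-a * t) = 1 := by
    rw [← Real.exp_add]; simp
  have hC0 : 0 ≤ C := le_trans (by positivity) (hC 1 (Set.mem_Ioi.2 one_pos))
  have hbound : ∀ t ∈ Set.Ioi (0 : ℝ), ‖g t‖ ≤ C * Real.exp (-a * t) := fun t ht => by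
    calc ‖g t‖ = Real.exp (a * t) * ‖g t‖ * Real.exp (-a * t) := by
          rw [mul_right_comm, hexp_mul, one_mul]
      _ ≤ C * Real.exp (-a * t) := by gcongr; exact hC t ht
  have hexp_int (x y : ℝ) :
      IntervalIntegrable (fun t => Real.exp (-a * t)) MeasureTheory.volume x y :=
    Continuous.intervalIntegrable (by fun_prop) x y
  have hint : ∀ t ∈ Set.Ioi (0 : ℝ), IntervalIntegrable g MeasureTheory.volume 0 t := by
    intro t ht
    rw [intervalIntegrable_iff_integrableOn_Ioc_of_le (le_of_lt ht)]
    exact integrableOn_of_exp_weight_bound measurableSet_Ioc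
      (hg.mono Set.Ioc_subset_Ioi_self) (fun s hs => hbound s hs.1)
      ((intervalIntegrable_iff_integrableOn_Ioc_of_le (le_of_lt ht)).1 (hexp_int 0 t))
  have hderiv : ∀ t ∈ Set.Ioi (0 : ℝ), HasDerivAt (fun u => ∫ s in (0 : ℝ)..u, g s) (g t) t :=
    fun t ht => intervalIntegral.integral_hasDerivAt_right (hint t ht)
      (hg.stronglyMeasurableAtFilter isOpen_Ioi t ht) (hg.continuousAt (Ioi_mem_nhds ht))
  rcases lt_or_gt_of_ne ha with hneg | hpos
  · refine ⟨_, hderiv, C * (-a)⁻¹, fun t ht => ?_⟩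
    have hle : ‖∫ s in (0 : ℝ)..t, g s‖ ≤ ∫ s in (0 : ℝ)..t, C * Real.exp (-a * s) :=
      intervalIntegral.norm_integral_le_of_norm_le (le_of_lt ht)
        (Filter.Eventually.of_forall fun s hs => hbound s hs.1) ((hexp_int 0 t).const_mul C)
    have hval : ∫ s in (0 : ℝ)..t, C * Real.exp (-a * s)
        = C * ((-a)⁻¹ * (Real.exp (-a * t) - 1)) := by
      rw [intervalIntegral.integral_const_mul,
        intervalIntegral.integral_comp_mul_left (fun x => Real.exp x) (neg_ne_zero.2 ha)]
      simp
    have hinv : 0 ≤ (-a)⁻¹ := inv_nonneg.2 (by linarith)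
    calc Real.exp (a * t) * ‖∫ s in (0 : ℝ)..t, g s‖
        ≤ Real.exp (a * t) * (C * ((-a)⁻¹ * Real.exp (-a * t))) := by
          gcongr
          rw [hval] at hle
          refine hle.trans ?_
          gcongr
          linarith
      _ = C * (-a)⁻¹ * (Real.exp (a * t) * Real.exp (-a * t)) := by ring
      _ = C * (-a)⁻¹ := by rw [hexp_mul, mul_one]
  · have hexp_Ioi (t : ℝ) :
        MeasureTheory.IntegrableOn (fun s => Real.exp (-a * s)) (Set.Ioi t) :=
      integrableOn_exp_mul_Ioi (by linarith) t
    have hgint : MeasureTheory.IntegrableOn g (Set.Ioi 0) :=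
      integrableOn_of_exp_weight_bound measurableSet_Ioi hg hbound (hexp_Ioi 0)
    refine ⟨fun u => (∫ s in (0 : ℝ)..u, g s) - ∫ s in Set.Ioi 0, g s,
      fun t ht => (hderiv t ht).sub_const _, C * a⁻¹, fun t ht => ?_⟩
    have htail : (∫ s in (0 : ℝ)..t, g s) - ∫ s in Set.Ioi 0, g s = -∫ s in Set.Ioi t, g s := by
      rw [← intervalIntegral.integral_interval_add_Ioi hgint
        (hgint.mono_set (Set.Ioi_subset_Ioi (le_of_lt ht)))]
      ring
    have hle : ‖∫ s in Set.Ioi t, g s‖ ≤ ∫ s in Set.Ioi t, C * Real.exp (-a * s) :=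
      MeasureTheory.norm_integral_le_of_norm_le ((hexp_Ioi t).const_mul C)
        ((MeasureTheory.ae_restrict_iff' measurableSet_Ioi).2
          (Filter.Eventually.of_forall fun s hs => hbound s (Set.mem_Ioi.2 (lt_trans ht hs))))
    have hval : ∫ s in Set.Ioi t, C * Real.exp (-a * s) = C * (a⁻¹ * Real.exp (-a * t)) := by
      rw [MeasureTheory.integral_const_mul, integral_exp_mul_Ioi (by linarith)]
      field_simp
    calc Real.exp (a * t) * ‖(∫ s in (0 : ℝ)..t, g s) - ∫ s in Set.Ioi 0, g s‖
        ≤ Real.exp (a * t) * (C * (a⁻¹ * Real.exp (-a * t))) := by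
          rw [htail, norm_neg, ← hval]
          gcongr
      _ = C * a⁻¹ * (Real.exp (a * t) * Real.exp (-a * t)) := by ring
      _ = C * a⁻¹ := by rw [hexp_mul, mul_one]
end

section
/- Let 1 ≤ p < ∞, let a ∈ ℝ with a ≠ 0, and let g : (0,∞) → ℂ be continuous with ∫₀^∞ (e^{a t}·‖g(t)‖)^p dt < ∞. Then there exists a differentiable function f : (0,∞) → ℂ such that f′(t) = g(t) for all t > 0 and ∫₀^∞ (e^{a t}·‖f(t)‖)^p dt < ∞. (This is the vanishing H^1_{(p)}((0,∞); w_a) = 0 for all a ≠ 0 and finite p.) -/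
open MeasureTheory Set
open scoped ENNReal

/-- Jensen's inequality for the power `p ≥ 1` and a measure of arbitrary total mass. -/
lemma lintegral_rpow_le_measure_univ_rpow_mul {α : Type*} {m : MeasurableSpace α}
    {μ : Measure α} {p : ℝ} (hp : 1 ≤ p) {φ : α → ℝ≥0∞} (hφ : Measurable φ) :
    (∫⁻ x, φ x ∂μ) ^ p ≤ μ univ ^ (p - 1) * ∫⁻ x, φ x ^ p ∂μ := by
  have hp0 : 0 < p := by linarith
  have h := eLpNorm'_le_eLpNorm'_mul_rpow_measure_univ (μ := μ) zero_lt_one hp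
    hφ.aestronglyMeasurable
  simp only [eLpNorm'_eq_lintegral_enorm, enorm_eq_self, ENNReal.rpow_one, div_one] at h
  calc (∫⁻ x, φ x ∂μ) ^ p
      ≤ ((∫⁻ x, φ x ^ p ∂μ) ^ (1 / p) * μ univ ^ (1 - 1 / p)) ^ p := by gcongr
    _ = μ univ ^ (p - 1) * ∫⁻ x, φ x ^ p ∂μ := by
      rw [ENNReal.mul_rpow_of_nonneg _ _ hp0.le, ← ENNReal.rpow_mul, ← ENNReal.rpow_mul,
        one_div_mul_cancel hp0.ne', ENNReal.rpow_one, mul_comm]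
      congr 2
      field_simp

/-- Jensen's inequality for a convolution with a nonnegative kernel. -/
lemma lintegral_kernel_rpow_le {p : ℝ} (hp : 1 ≤ p) {K φ : ℝ → ℝ≥0∞} (hK : Measurable K)
    (hφ : Measurable φ) (t : ℝ) :
    (∫⁻ s, K (t - s) * φ s) ^ p ≤
      (∫⁻ s, K s) ^ (p - 1) * ∫⁻ s, K (t - s) * φ s ^ p := by
  have hKt : Measurable fun s => K (t - s) := by fun_prop
  have h := lintegral_rpow_le_measure_univ_rpow_mul
    (μ := volume.withDensity fun s => K (t - s)) hp hφ
  rw [lintegral_withDensity_eq_lintegral_mul _ hKt hφ,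
    lintegral_withDensity_eq_lintegral_mul _ hKt (hφ.pow_const p),
    withDensity_apply _ MeasurableSet.univ, setLIntegral_univ,
    lintegral_sub_left_eq_self K t] at h
  exact h

/-- Young's convolution inequality `L¹ * Lᵖ ⊆ Lᵖ` for nonnegative functions on the line. -/
lemma lintegral_lintegral_kernel_rpow_le {p : ℝ} (hp : 1 ≤ p) {K φ : ℝ → ℝ≥0∞}
    (hK : Measurable K) (hφ : Measurable φ) :
    ∫⁻ t, (∫⁻ s, K (t - s) * φ s) ^ p ≤
      (∫⁻ s, K s) ^ (p - 1) * ((∫⁻ s, K s) * ∫⁻ s, φ s ^ p) := by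
  have hmeas : Measurable (Function.uncurry fun t s : ℝ => K (t - s) * φ s ^ p) := by
    unfold Function.uncurry
    fun_prop
  calc ∫⁻ t, (∫⁻ s, K (t - s) * φ s) ^ p
      ≤ ∫⁻ t, (∫⁻ s, K s) ^ (p - 1) * ∫⁻ s, K (t - s) * φ s ^ p :=
        lintegral_mono fun t => lintegral_kernel_rpow_le hp hK hφ t
    _ = (∫⁻ s, K s) ^ (p - 1) * ∫⁻ t, ∫⁻ s, K (t - s) * φ s ^ p :=
        lintegral_const_mul _ hmeas.lintegral_prod_right'
    _ = (∫⁻ s, K s) ^ (p - 1) * ∫⁻ s, ∫⁻ t, K (t - s) * φ s ^ p := by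
        rw [lintegral_lintegral_swap hmeas.aemeasurable]
    _ = (∫⁻ s, K s) ^ (p - 1) * ((∫⁻ s, K s) * ∫⁻ s, φ s ^ p) := by
        rw [← lintegral_const_mul _ (hφ.pow_const p)]
        congr 1
        refine lintegral_congr fun s => ?_
        rw [lintegral_mul_const _ (by fun_prop), lintegral_sub_right_eq_self K s]

lemma lintegral_exp_neg_mul_abs_lt_top {b : ℝ} (hb : 0 < b) :
    ∫⁻ u : ℝ, ENNReal.ofReal (Real.exp (-(b * |u|))) < ∞ := by
  have h1 : IntegrableOn (fun u : ℝ => Real.exp (-(b * |u|))) (Iic 0) :=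
    (integrableOn_exp_mul_Iic hb 0).congr_fun
      (fun u hu => by simp [abs_of_nonpos (mem_Iic.1 hu)]) measurableSet_Iic
  have h2 : IntegrableOn (fun u : ℝ => Real.exp (-(b * |u|))) (Ioi 0) :=
    (integrableOn_exp_mul_Ioi (neg_lt_zero.2 hb) 0).congr_fun
      (fun u hu => by simp [abs_of_pos (mem_Ioi.1 hu)]) measurableSet_Ioi
  have h := h1.union h2
  rw [Iic_union_Ioi, integrableOn_univ] at h
  exact h.lintegral_lt_top

/-- If `S` lies on the side of `t` where `a * (t - s)` is nonpositive, the weighted integral of `h`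
over `S` is dominated by the convolution of the weighted norm with `exp (-|a| |·|)`. -/
lemma ofReal_exp_mul_setLIntegral_le {a t : ℝ} {h : ℝ → ℂ} {S : Set ℝ} (hSm : MeasurableSet S)
    (hS : ∀ s ∈ S, a * (t - s) ≤ 0) :
    ENNReal.ofReal (Real.exp (a * t)) * ∫⁻ s in S, ‖h s‖ₑ ≤
      ∫⁻ s, ENNReal.ofReal (Real.exp (-(|a| * |t - s|))) *
        (ENNReal.ofReal (Real.exp (a * s)) * ‖h s‖ₑ) := by
  rw [← lintegral_const_mul' _ _ ENNReal.ofReal_ne_top]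
  refine le_trans (le_of_eq ?_) (setLIntegral_le_lintegral S _)
  refine setLIntegral_congr_fun hSm fun s hs => ?_
  rw [← abs_mul, abs_of_nonpos (hS s hs), ← mul_assoc,
    ← ENNReal.ofReal_mul (Real.exp_nonneg _), ← Real.exp_add]
  ring_nf

/-- A function with increments `∫ x in b..t, h x` is a primitive of `h` where `h` is continuous. -/
lemma hasDerivAt_of_sub_eq_intervalIntegral {f h : ℝ → ℂ} (hh : Measurable h)
    (hint : ∀ b t, IntervalIntegrable h volume b t)
    (hf : ∀ b t, f t - f b = ∫ x in b..t, h x) {t : ℝ} (hc : ContinuousAt h t) :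
    HasDerivAt f (h t) t := by
  have hd := intervalIntegral.integral_hasDerivAt_right (hint 0 t)
    hh.stronglyMeasurable.stronglyMeasurableAtFilter hc
  refine (hd.add_const (f 0)).congr_of_eventuallyEq (.of_forall fun u => ?_)
  simp only [← hf, sub_add_cancel]

theorem weighted_Lp_H1_vanishes (p a : ℝ) (hp : 1 ≤ p) (ha : a ≠ 0) (g : ℝ → ℂ)
    (hg : ContinuousOn g (Set.Ioi (0 : ℝ)))
    (hgLp : MeasureTheory.IntegrableOn
      (fun t => (Real.exp (a * t) * ‖g t‖) ^ p) (Set.Ioi (0 : ℝ))) :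
    ∃ f : ℝ → ℂ,
      (∀ t ∈ Set.Ioi (0 : ℝ), HasDerivAt f (g t) t) ∧
      MeasureTheory.IntegrableOn
        (fun t => (Real.exp (a * t) * ‖f t‖) ^ p) (Set.Ioi (0 : ℝ)) := by
  classical
  have hp0 : 0 < p := by linarith
  set h : ℝ → ℂ := (Ioi (0 : ℝ)).piecewise g 0 with hh_def
  have hh : Measurable h := hg.measurable_piecewise continuousOn_const measurableSet_Ioi
  have hhg : ∀ t ∈ Ioi (0 : ℝ), h t = g t := fun t ht => piecewise_eq_of_mem _ _ _ ht
  have hhc : ∀ t ∈ Ioi (0 : ℝ), ContinuousAt h t := fun t ht =>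
    (hg.continuousAt (Ioi_mem_nhds ht)).congr
      (Filter.eventually_of_mem (Ioi_mem_nhds ht) fun s hs => (hhg s hs).symm)
  set K : ℝ → ℝ≥0∞ := fun u => ENNReal.ofReal (Real.exp (-(|a| * |u|))) with hK_def
  set φ : ℝ → ℝ≥0∞ := fun s => ENNReal.ofReal (Real.exp (a * s)) * ‖h s‖ₑ with hφ_def
  have hK : Measurable K := by fun_prop
  have hφ : Measurable φ := by fun_prop
  have hweight : ∀ (t : ℝ) (z : ℂ), ‖(Real.exp (a * t) * ‖z‖) ^ p‖ₑ =
      (ENNReal.ofReal (Real.exp (a * t)) * ‖z‖ₑ) ^ p := fun t z => by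
    rw [Real.enorm_of_nonneg (by positivity), ← ENNReal.ofReal_rpow_of_nonneg (by positivity) hp0.le,
      ENNReal.ofReal_mul (Real.exp_nonneg _), ofReal_norm]
  have hK_top : ∫⁻ u, K u < ∞ := lintegral_exp_neg_mul_abs_lt_top (abs_pos.2 ha)
  have hφ_top : ∫⁻ s, φ s ^ p < ∞ := by
    have h1 := hasFiniteIntegral_iff_enorm.1 hgLp.2
    rw [← lintegral_indicator measurableSet_Ioi] at h1
    refine lt_of_le_of_lt (lintegral_mono fun s => ?_) h1
    by_cases hs : s ∈ Ioi (0 : ℝ)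
    · rw [indicator_of_mem hs, hweight, ← hhg s hs]
    · simp [hφ_def, hh_def, hs, hp0]
  have hconv : ∀ t, ∫⁻ s, K (t - s) * φ s < ∞ := fun t => by
    rw [← ENNReal.rpow_lt_top_iff_of_pos hp0]
    refine (lintegral_kernel_rpow_le hp hK hφ t).trans_lt (ENNReal.mul_lt_top
      (ENNReal.rpow_lt_top_of_nonneg (by linarith) hK_top.ne) ?_)
    refine lt_of_le_of_lt (lintegral_mono fun s => mul_le_of_le_one_left' ?_) hφ_top
    exact ENNReal.ofReal_le_one.2 (Real.exp_le_one_iff.2 (neg_nonpos.2 (by positivity)))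
  have hint : ∀ (t : ℝ) (S : Set ℝ), MeasurableSet S → (∀ s ∈ S, a * (t - s) ≤ 0) →
      IntegrableOn h S := fun t S hSm hS => by
    refine ⟨hh.aestronglyMeasurable, hasFiniteIntegral_iff_enorm.2 ?_⟩
    have h1 := (ofReal_exp_mul_setLIntegral_le (h := h) hSm hS).trans_lt (hconv t)
    exact ENNReal.lt_top_of_mul_ne_top_right h1.ne
      (ENNReal.ofReal_pos.2 (Real.exp_pos _)).ne'
  obtain ⟨f, S, hSm, hS, hfS, hhI, hfI⟩ : ∃ (f : ℝ → ℂ) (S : ℝ → Set ℝ),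
      (∀ t, MeasurableSet (S t)) ∧ (∀ t, ∀ s ∈ S t, a * (t - s) ≤ 0) ∧
      (∀ t, ‖f t‖ = ‖∫ s in S t, h s‖) ∧ (∀ b t, IntervalIntegrable h volume b t) ∧
      ∀ b t, f t - f b = ∫ x in b..t, h x := by
    rcases ha.lt_or_gt with ha | ha
    · have hS : ∀ t, ∀ s ∈ Iic t, a * (t - s) ≤ 0 := fun t s hs =>
        mul_nonpos_of_nonpos_of_nonneg ha.le (sub_nonneg.2 hs)
      have hI : ∀ t, IntegrableOn h (Iic t) := fun t => hint t _ measurableSet_Iic (hS t)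
      exact ⟨fun t => ∫ s in Iic t, h s, Iic, fun _ => measurableSet_Iic, hS, fun _ => rfl,
        fun b t => ⟨(hI t).mono_set Ioc_subset_Iic_self, (hI b).mono_set Ioc_subset_Iic_self⟩,
        fun b t => intervalIntegral.integral_Iic_sub_Iic (hI b) (hI t)⟩
    · have hS : ∀ t, ∀ s ∈ Ioi t, a * (t - s) ≤ 0 := fun t s hs =>
        mul_nonpos_of_nonneg_of_nonpos ha.le (sub_nonpos.2 (le_of_lt hs))
      have hI : ∀ t, IntegrableOn h (Ioi t) := fun t => hint t _ measurableSet_Ioi (hS t)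
      refine ⟨fun t => -∫ s in Ioi t, h s, Ioi, fun _ => measurableSet_Ioi, hS,
        fun _ => norm_neg _,
        fun b t => ⟨(hI b).mono_set Ioc_subset_Ioi_self, (hI t).mono_set Ioc_subset_Ioi_self⟩,
        fun b t => ?_⟩
      simp only [← intervalIntegral.integral_interval_add_Ioi (hI b) (hI t)]
      ring
  have hderiv : ∀ t ∈ Ioi (0 : ℝ), HasDerivAt f (g t) t := fun t ht => by
    rw [← hhg t ht]
    exact hasDerivAt_of_sub_eq_intervalIntegral hh hhI hfI (hhc t ht)
  refine ⟨f, hderiv, ?_, hasFiniteIntegral_iff_enorm.2 ?_⟩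
  · refine ContinuousOn.aestronglyMeasurable (fun t ht => ?_) measurableSet_Ioi
    have hft := (hderiv t ht).continuousAt
    exact (ContinuousAt.rpow_const (by fun_prop) (Or.inr hp0.le)).continuousWithinAt
  · refine (setLIntegral_le_lintegral _ _).trans_lt (lt_of_le_of_lt (lintegral_mono fun t => ?_)
      ((lintegral_lintegral_kernel_rpow_le hp hK hφ).trans_lt (ENNReal.mul_lt_top
        (ENNReal.rpow_lt_top_of_nonneg (by linarith) hK_top.ne)
        (ENNReal.mul_lt_top hK_top hφ_top))))
    rw [hweight]
    gcongr
    refine le_trans ?_ (ofReal_exp_mul_setLIntegral_le (h := h) (hSm t) (hS t))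
    gcongr
    rw [enorm_eq_iff_norm_eq.2 (hfS t)]
    exact enorm_integral_le_lintegral_enorm _
end

section
/- Let w : ℝ → ℝ be a positive, bounded, non-decreasing function, let ψ : ℝ → ℝ be integrable with support contained in (-∞, 0], and let f : ℝ → ℂ be measurable with f(x) = 0 for all x ≤ 0 and with w(x)·‖f(x)‖ ≤ M for almost every x > 0. Then for every t ∈ ℝ the integral (ψ∗f)(t) = ∫_ℝ ψ(t−x) f(x) dx converges absolutely, and w(t)·‖(ψ∗f)(t)‖ ≤ M·∫_ℝ |ψ(x)| dx. In particular, the convolution ψ∗f is again L^∞ with weight w. -/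
open MeasureTheory

theorem convolution_weighted_Linfty_bounded_monotone_weight
    (w : ℝ → ℝ) (hw_pos : ∀ x, 0 < w x) (hw_bdd : ∃ B : ℝ, ∀ x, w x ≤ B)
    (hw_mono : Monotone w)
    (ψ : ℝ → ℝ) (hψ : Integrable ψ) (hψ_supp : Function.support ψ ⊆ Set.Iic (0 : ℝ))
    (f : ℝ → ℂ) (hf_meas : Measurable f) (hf_zero : ∀ x ≤ (0 : ℝ), f x = 0)
    (M : ℝ) (hf_bd : ∀ᵐ x : ℝ, 0 < x → w x * ‖f x‖ ≤ M) :
    (∀ t : ℝ, Integrable (fun x => ψ (t - x) • f x)) ∧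
    (∀ t : ℝ, w t * ‖∫ x, ψ (t - x) • f x‖ ≤ M * ∫ x, |ψ x|) := by
  have hM : 0 ≤ M := by
    by_contra! h
    have hae : ∀ᵐ x : ℝ, ¬ 0 < x := by
      filter_upwards [hf_bd] with x hx hpos
      have := mul_nonneg (hw_pos x).le (norm_nonneg (f x))
      linarith [hx hpos]
    have hzero : volume (Set.Ioi (0 : ℝ)) = 0 := by
      simpa [ae_iff, Set.Ioi] using hae
    simp at hzero
  have hψt (t : ℝ) : Integrable fun x => ψ (t - x) := hψ.comp_sub_left t
  have hbound (t : ℝ) : ∀ᵐ x : ℝ, ‖ψ (t - x) • f x‖ ≤ M / w t * |ψ (t - x)| := by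
    filter_upwards [hf_bd] with x hx
    rw [norm_smul, Real.norm_eq_abs, mul_comm]
    rcases eq_or_ne (ψ (t - x)) 0 with h | h
    · simp [h]
    refine mul_le_mul_of_nonneg_right ?_ (abs_nonneg _)
    rcases le_or_gt x 0 with hx0 | hx0
    · simpa [hf_zero x hx0] using div_nonneg hM (hw_pos t).le
    · have htx : t ≤ x := sub_nonpos.mp (hψ_supp h)
      rw [le_div_iff₀' (hw_pos t)]
      exact (mul_le_mul_of_nonneg_right (hw_mono htx) (norm_nonneg _)).trans (hx hx0)
  refine ⟨fun t => ((hψt t).abs.const_mul _).mono'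
    ((hψt t).aestronglyMeasurable.smul hf_meas.aestronglyMeasurable) (hbound t), fun t => ?_⟩
  have h := norm_integral_le_of_norm_le ((hψt t).abs.const_mul (M / w t)) (hbound t)
  rw [integral_const_mul, integral_sub_left_eq_self (fun x => |ψ x|) volume t, div_mul_eq_mul_div,
    le_div_iff₀' (hw_pos t)] at h
  exact h
end

section
/- Let w : (0,∞) → ℝ be a positive, non-increasing (antitone) function (the case of interest being when w(t) → ∞ as t → 0⁺), let ψ : ℝ → ℝ be integrable with support contained in [0, ∞), and let f : ℝ → ℂ be measurable with f(x) = 0 for all x ≤ 0 and with w(x)·‖f(x)‖ ≤ M for almost every x > 0. Then for every t > 0 the integral (ψ∗f)(t) = ∫_ℝ ψ(t−x) f(x) dx converges absolutely, and w(t)·‖(ψ∗f)(t)‖ ≤ M·∫_ℝ |ψ(x)| dx. In particular, the convolution ψ∗f is again L^∞ with weight w on (0,∞). -/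
open MeasureTheory

/-- An almost everywhere upper bound on `(0, ∞)` for a nonnegative function is nonnegative. -/
lemma nonneg_of_ae_pos_le {g : ℝ → ℝ} {M : ℝ} (hg : ∀ x, 0 < x → 0 ≤ g x)
    (h : ∀ᵐ x : ℝ, 0 < x → g x ≤ M) : 0 ≤ M := by
  have hfreq : ∃ᵐ x : ℝ, x ∈ Set.Ioi (0 : ℝ) :=
    frequently_ae_mem_iff.2 (by simp)
  obtain ⟨x, hx, hxM⟩ := (hfreq.and_eventually h).exists
  exact (hg x hx).trans (hxM hx)

/-- Only `0 < x ≤ t` contributes to the convolution integrand at `t`, and there `w t ≤ w x`. -/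
lemma ae_norm_convolution_integrand_le {w ψ : ℝ → ℝ} {f : ℝ → ℂ} {M t : ℝ}
    (hw_pos : ∀ x ∈ Set.Ioi (0 : ℝ), 0 < w x) (hw_anti : AntitoneOn w (Set.Ioi (0 : ℝ)))
    (hψ_supp : Function.support ψ ⊆ Set.Ici (0 : ℝ)) (hf_zero : ∀ x ≤ (0 : ℝ), f x = 0)
    (hf_bd : ∀ᵐ x : ℝ, 0 < x → w x * ‖f x‖ ≤ M) (ht : 0 < t) :
    ∀ᵐ x : ℝ, ‖ψ (t - x) • f x‖ ≤ M / w t * |ψ (t - x)| := by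
  have hM : 0 ≤ M :=
    nonneg_of_ae_pos_le (fun x hx => mul_nonneg (hw_pos x hx).le (norm_nonneg _)) hf_bd
  have hwt : 0 < w t := hw_pos t ht
  filter_upwards [hf_bd] with x hx
  rw [norm_smul, Real.norm_eq_abs, mul_comm]
  by_cases hψx : ψ (t - x) = 0
  · simp [hψx]
  have hxt : x ≤ t := sub_nonneg.1 (hψ_supp hψx)
  refine mul_le_mul_of_nonneg_right ?_ (abs_nonneg _)
  rcases le_or_gt x 0 with hx0 | hx0
  · rw [hf_zero x hx0, norm_zero]
    positivity
  · rw [le_div_iff₀' hwt]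
    exact (mul_le_mul_of_nonneg_right (hw_anti hx0 ht hxt) (norm_nonneg _)).trans (hx hx0)

theorem convolution_weighted_Linfty_antitone_weight
    (w : ℝ → ℝ) (hw_pos : ∀ x ∈ Set.Ioi (0 : ℝ), 0 < w x)
    (hw_anti : AntitoneOn w (Set.Ioi (0 : ℝ)))
    (ψ : ℝ → ℝ) (hψ : Integrable ψ) (hψ_supp : Function.support ψ ⊆ Set.Ici (0 : ℝ))
    (f : ℝ → ℂ) (hf_meas : Measurable f) (hf_zero : ∀ x ≤ (0 : ℝ), f x = 0)
    (M : ℝ) (hf_bd : ∀ᵐ x : ℝ, 0 < x → w x * ‖f x‖ ≤ M) :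
    (∀ t ∈ Set.Ioi (0 : ℝ), Integrable (fun x => ψ (t - x) • f x)) ∧
    (∀ t ∈ Set.Ioi (0 : ℝ), w t * ‖∫ x, ψ (t - x) • f x‖ ≤ M * ∫ x, |ψ x|) := by
  have hbound (t : ℝ) (ht : 0 < t) :=
    ae_norm_convolution_integrand_le hw_pos hw_anti hψ_supp hf_zero hf_bd ht
  have hint (t : ℝ) : Integrable fun x => M / w t * |ψ (t - x)| :=
    (hψ.comp_sub_left t).abs.const_mul _
  refine ⟨fun t ht => (hint t).mono' ?_ (hbound t ht), fun t ht => ?_⟩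
  · exact (hψ.comp_sub_left t).aestronglyMeasurable.smul hf_meas.aestronglyMeasurable
  · have hwt : 0 < w t := hw_pos t ht
    calc w t * ‖∫ x, ψ (t - x) • f x‖
        ≤ w t * ∫ x, M / w t * |ψ (t - x)| :=
          mul_le_mul_of_nonneg_left (norm_integral_le_of_norm_le (hint t) (hbound t ht)) hwt.le
      _ = M * ∫ x, |ψ x| := by
          rw [integral_const_mul, integral_sub_left_eq_self (fun x => |ψ x|) volume t,
            ← mul_assoc, mul_div_cancel₀ _ hwt.ne']
end

section
/- Let 1 ≤ p < ∞, let w : ℝ → ℝ be a positive, bounded, non-decreasing function, let ψ : ℝ → ℝ be integrable with support contained in (-∞, 0], and let f : ℝ → ℂ be measurable with f(x) = 0 for all x ≤ 0 and with ∫₀^∞ (w(x)·‖f(x)‖)^p dx < ∞. Then for almost every t the integral (ψ∗f)(t) = ∫_ℝ ψ(t−x) f(x) dx converges absolutely, and (∫_ℝ (w(t)·‖(ψ∗f)(t)‖)^p dt)^{1/p} ≤ (∫_ℝ |ψ(x)| dx) · (∫₀^∞ (w(x)·‖f(x)‖)^p dx)^{1/p}. In particular, the convolution ψ∗f is again L^p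 with weight w. -/
open MeasureTheory

open scoped ENNReal in
/-- Hölder's inequality with respect to the measure of density `k`. -/
theorem lintegral_mul_rpow_le_lintegral_rpow_mul {α : Type*} [MeasurableSpace α] {μ : Measure α}
    {p : ℝ} (hp : 1 ≤ p) {k g : α → ℝ≥0∞} (hk : AEMeasurable k μ) (hg : AEMeasurable g μ) :
    (∫⁻ x, k x * g x ∂μ) ^ p ≤ (∫⁻ x, k x ∂μ) ^ (p - 1) * ∫⁻ x, k x * g x ^ p ∂μ := by
  have hp0 : 0 < p := by linarith
  have hinv : 0 ≤ 1 - p⁻¹ := sub_nonneg.2 (inv_le_one_of_one_le₀ hp)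
  have key := ENNReal.lintegral_mul_norm_pow_le hk (hk.mul (hg.pow_const p)) hinv
    (inv_nonneg.2 hp0.le) (sub_add_cancel 1 p⁻¹)
  have heq : ∀ x, k x ^ (1 - p⁻¹) * (k x * g x ^ p) ^ p⁻¹ = k x * g x := fun x => by
    rw [ENNReal.mul_rpow_of_nonneg _ _ (inv_nonneg.2 hp0.le), ← ENNReal.rpow_mul,
      mul_inv_cancel₀ hp0.ne', ENNReal.rpow_one, ← mul_assoc,
      ← ENNReal.rpow_add_of_nonneg _ _ hinv (inv_nonneg.2 hp0.le), sub_add_cancel,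
      ENNReal.rpow_one]
  simp only [Pi.mul_apply, heq] at key
  calc (∫⁻ x, k x * g x ∂μ) ^ p
      ≤ ((∫⁻ x, k x ∂μ) ^ (1 - p⁻¹) * (∫⁻ x, k x * g x ^ p ∂μ) ^ p⁻¹) ^ p := by gcongr
    _ = _ := by
      rw [ENNReal.mul_rpow_of_nonneg _ _ hp0.le, ← ENNReal.rpow_mul, ← ENNReal.rpow_mul,
        inv_mul_cancel₀ hp0.ne', ENNReal.rpow_one, sub_mul, one_mul, inv_mul_cancel₀ hp0.ne']

open scoped ENNReal in
/-- Young's convolution inequality `L¹ * Lᵖ ⊆ Lᵖ` for nonnegative functions. -/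
theorem lintegral_rpow_lintegral_sub_mul_le {G : Type*} [AddCommGroup G] [MeasurableSpace G]
    [MeasurableAdd₂ G] [MeasurableNeg G] {μ : Measure G} [SFinite μ] [μ.IsAddLeftInvariant]
    [μ.IsNegInvariant] {p : ℝ} (hp : 1 ≤ p) {k g : G → ℝ≥0∞} (hk : AEMeasurable k μ)
    (hg : AEMeasurable g μ) :
    ∫⁻ t, (∫⁻ x, k (t - x) * g x ∂μ) ^ p ∂μ ≤ (∫⁻ x, k x ∂μ) ^ p * ∫⁻ x, g x ^ p ∂μ := by
  have hsub : AEMeasurable (fun z : G × G => k (z.1 - z.2)) (μ.prod μ) :=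
    hk.comp_quasiMeasurePreserving (quasiMeasurePreserving_sub_of_right_invariant μ μ)
  have hprod : AEMeasurable (fun z : G × G => k (z.1 - z.2) * g z.2 ^ p) (μ.prod μ) :=
    hsub.mul (hg.pow_const p).comp_snd
  calc ∫⁻ t, (∫⁻ x, k (t - x) * g x ∂μ) ^ p ∂μ
      ≤ ∫⁻ t, (∫⁻ x, k x ∂μ) ^ (p - 1) * ∫⁻ x, k (t - x) * g x ^ p ∂μ ∂μ := by
        refine lintegral_mono fun t => ?_
        rw [← lintegral_sub_left_eq_self k t]
        exact lintegral_mul_rpow_le_lintegral_rpow_mul hp (hk.comp_quasiMeasurePreserving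
          (quasiMeasurePreserving_sub_left μ t)) hg
    _ = (∫⁻ x, k x ∂μ) ^ (p - 1) * ∫⁻ x, ∫⁻ t, k (t - x) * g x ^ p ∂μ ∂μ := by
        rw [lintegral_const_mul'' _ hprod.lintegral_prod_right', lintegral_lintegral_swap hprod]
    _ = (∫⁻ x, k x ∂μ) ^ (p - 1) * ((∫⁻ x, k x ∂μ) * ∫⁻ x, g x ^ p ∂μ) := by
        have hinner : ∀ x, ∫⁻ t, k (t - x) * g x ^ p ∂μ = (∫⁻ t, k t ∂μ) * g x ^ p := fun x => by
          have hkx : AEMeasurable (fun t => k (t - x)) μ :=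
            hk.comp_quasiMeasurePreserving (measurePreserving_sub_right μ x).quasiMeasurePreserving
          rw [lintegral_mul_const'' _ hkx, lintegral_sub_right_eq_self k x]
        simp_rw [hinner]
        rw [lintegral_const_mul'' _ (hg.pow_const p)]
    _ = (∫⁻ x, k x ∂μ) ^ p * ∫⁻ x, g x ^ p ∂μ := by
        rw [← mul_assoc]
        congr 1
        conv_lhs => enter [2]; rw [← ENNReal.rpow_one (∫⁻ x, k x ∂μ)]
        rw [← ENNReal.rpow_add_of_nonneg _ _ (by linarith) zero_le_one, sub_add_cancel]

theorem convolution_weighted_Lp_bounded_monotone_weight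
    (p : ℝ) (hp : 1 ≤ p)
    (w : ℝ → ℝ) (hw_pos : ∀ x, 0 < w x) (hw_bdd : ∃ B : ℝ, ∀ x, w x ≤ B)
    (hw_mono : Monotone w)
    (ψ : ℝ → ℝ) (hψ : Integrable ψ) (hψ_supp : Function.support ψ ⊆ Set.Iic (0 : ℝ))
    (f : ℝ → ℂ) (hf_meas : Measurable f) (hf_zero : ∀ x ≤ (0 : ℝ), f x = 0)
    (hf_Lp : ∫⁻ x in Set.Ioi (0 : ℝ), ENNReal.ofReal ((w x * ‖f x‖) ^ p) < ⊤) :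
    (∀ᵐ t : ℝ, Integrable (fun x => ψ (t - x) • f x)) ∧
    (∫⁻ t : ℝ, ENNReal.ofReal ((w t * ‖∫ x, ψ (t - x) • f x‖) ^ p)) ^ (1 / p) ≤
      ENNReal.ofReal (∫ x, |ψ x|) *
        (∫⁻ x in Set.Ioi (0 : ℝ), ENNReal.ofReal ((w x * ‖f x‖) ^ p)) ^ (1 / p) := by
  have hp0 : 0 < p := by linarith
  have hofReal : ∀ (t : ℝ) (z : ℂ),
      ENNReal.ofReal ((w t * ‖z‖) ^ p) = (ENNReal.ofReal (w t) * ‖z‖ₑ) ^ p := fun t z => by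
    rw [← ENNReal.ofReal_rpow_of_nonneg (mul_nonneg (hw_pos t).le (norm_nonneg z)) hp0.le,
      ENNReal.ofReal_mul (hw_pos t).le, ofReal_norm]
  simp only [hofReal] at hf_Lp ⊢
  have hg : Measurable fun x => ENNReal.ofReal (w x) * ‖f x‖ₑ :=
    hw_mono.measurable.ennreal_ofReal.mul hf_meas.enorm
  have hset : ∫⁻ x in Set.Ioi (0 : ℝ), (ENNReal.ofReal (w x) * ‖f x‖ₑ) ^ p =
      ∫⁻ x, (ENNReal.ofReal (w x) * ‖f x‖ₑ) ^ p := by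
    refine setLIntegral_eq_of_support_subset ?_
    intro x hx
    by_contra hx0
    exact hx (by simp [hf_zero x (not_lt.1 hx0), hp0])
  rw [hset] at hf_Lp ⊢
  have hψ_norm : ENNReal.ofReal (∫ x, |ψ x|) = ∫⁻ x, ‖ψ x‖ₑ := by
    simpa only [Real.norm_eq_abs] using ofReal_integral_norm_eq_lintegral_enorm hψ
  have hyoung := lintegral_rpow_lintegral_sub_mul_le hp hψ.1.enorm hg.aemeasurable
  have hweight : ∀ t, ENNReal.ofReal (w t) * ∫⁻ x, ‖ψ (t - x) • f x‖ₑ ≤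
      ∫⁻ x, ‖ψ (t - x)‖ₑ * (ENNReal.ofReal (w x) * ‖f x‖ₑ) := fun t => by
    rw [← lintegral_const_mul' _ _ ENNReal.ofReal_ne_top]
    refine lintegral_mono fun x => ?_
    rw [enorm_smul, mul_left_comm]
    by_cases htx : ψ (t - x) = 0
    · simp [htx]
    · gcongr
      exact hw_mono (sub_nonpos.1 (hψ_supp htx))
  have hle : ∫⁻ t, (ENNReal.ofReal (w t) * ∫⁻ x, ‖ψ (t - x) • f x‖ₑ) ^ p ≤
      (∫⁻ x, ‖ψ x‖ₑ) ^ p * ∫⁻ x, (ENNReal.ofReal (w x) * ‖f x‖ₑ) ^ p :=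
    (lintegral_mono fun t => ENNReal.rpow_le_rpow (hweight t) hp0.le).trans hyoung
  refine ⟨?_, ?_⟩
  · have hmeas : AEMeasurable fun t => ∫⁻ x, ‖ψ (t - x) • f x‖ₑ := by
      have : AEStronglyMeasurable (fun z : ℝ × ℝ => ψ (z.1 - z.2) • f z.2)
          (volume.prod volume) :=
        (hψ.1.comp_quasiMeasurePreserving
          (quasiMeasurePreserving_sub_of_right_invariant volume volume)).smul
          hf_meas.aestronglyMeasurable.comp_snd
      exact this.enorm.lintegral_prod_right'
    have hfin : (∫⁻ x, ‖ψ x‖ₑ) ^ p * ∫⁻ x, (ENNReal.ofReal (w x) * ‖f x‖ₑ) ^ p < ⊤ :=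
      ENNReal.mul_lt_top (ENNReal.rpow_lt_top_of_nonneg hp0.le hψ.2.ne) hf_Lp
    filter_upwards [ae_lt_top' ((hw_mono.measurable.ennreal_ofReal.aemeasurable.mul
      hmeas).pow_const p) (hle.trans_lt hfin).ne] with t ht
    refine ⟨(hψ.1.comp_quasiMeasurePreserving (quasiMeasurePreserving_sub_left volume t)).smul
      hf_meas.aestronglyMeasurable, ?_⟩
    refine lt_top_iff_ne_top.2 fun htop => ?_
    beta_reduce at htop
    rw [Pi.mul_apply, htop, ENNReal.mul_top (ENNReal.ofReal_pos.2 (hw_pos t)).ne',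
      ENNReal.top_rpow_of_pos hp0] at ht
    exact ht.false
  · calc (∫⁻ t, (ENNReal.ofReal (w t) * ‖∫ x, ψ (t - x) • f x‖ₑ) ^ p) ^ (1 / p)
        ≤ ((∫⁻ x, ‖ψ x‖ₑ) ^ p * ∫⁻ x, (ENNReal.ofReal (w x) * ‖f x‖ₑ) ^ p) ^ (1 / p) := by
          refine ENNReal.rpow_le_rpow (le_trans ?_ hle) (by positivity)
          gcongr
          exact enorm_integral_le_lintegral_enorm _
      _ = _ := by
          rw [ENNReal.mul_rpow_of_nonneg _ _ (by positivity), ← ENNReal.rpow_mul,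
            mul_one_div_cancel hp0.ne', ENNReal.rpow_one, hψ_norm]
end

section
/- Let n ≥ 1, let ν₁, …, νₙ be pairwise distinct real numbers with 0 ≤ νᵢ ≤ 1 for each i, and let c₁, …, cₙ ∈ ℂ. Suppose f : (1,∞) → ℂ is differentiable with f′(t) = Σᵢ cᵢ·t^{−νᵢ} for all t > 1, and f is bounded on (1,∞). Then cᵢ = 0 for every i. (Consequently the cohomology classes of the 1-forms t^{−ν} dt, for 0 ≤ ν ≤ 1, are linearly independent in the first unweighted L^∞-cohomology of the half-line, which is therefore infinite-dimensional.) -/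
open Filter Topology in
/-- A real function whose derivative is eventually at least `a / t`, with `a > 0`, is not bounded
above near infinity. -/
theorem not_eventually_le_of_div_le_deriv {h h' : ℝ → ℝ} {a B : ℝ} (ha : 0 < a)
    (hd : ∀ᶠ t in atTop, HasDerivAt h (h' t) t) (hge : ∀ᶠ t in atTop, a / t ≤ h' t) :
    ¬ ∀ᶠ t in atTop, h t ≤ B := by
  intro hB
  obtain ⟨T, hT⟩ := eventually_atTop.1 ((hd.and hge).and (eventually_gt_atTop (0 : ℝ)))
  have hderiv : ∀ t, T ≤ t → HasDerivAt (fun s => h s - a * Real.log s) (h' t - a * t⁻¹) t :=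
    fun t ht => (hT t ht).1.1.sub ((Real.hasDerivAt_log (hT t ht).2.ne').const_mul a)
  have hmono : MonotoneOn (fun s => h s - a * Real.log s) (Set.Ici T) := by
    refine monotoneOn_of_hasDerivWithinAt_nonneg (f' := fun t => h' t - a * t⁻¹)
      (convex_Ici T) (fun t ht => (hderiv t ht).continuousAt.continuousWithinAt) ?_ ?_
    · intro t ht
      exact (hderiv t (interior_subset ht)).hasDerivWithinAt
    · intro t ht
      have := (hT t (interior_subset ht)).1.2
      rw [div_eq_mul_inv] at this
      linarith
  have hlog : Tendsto (fun t => a * Real.log t) atTop atTop :=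
    Real.tendsto_log_atTop.const_mul_atTop ha
  obtain ⟨t, ⟨htB, htT⟩, htlog⟩ := ((hB.and (eventually_ge_atTop T)).and
    (hlog.eventually_gt_atTop (B - (h T - a * Real.log T)))).exists
  have := hmono (Set.mem_Ici.2 le_rfl) (Set.mem_Ici.2 htT) htT
  simp only at this
  linarith

open Filter Topology ComplexConjugate in
/-- If `f` is bounded near infinity and `t ^ m * f' t` converges to `c` for some `m ≤ 1`,
then `c = 0`. -/
theorem eq_zero_of_tendsto_rpow_mul_deriv_of_bounded {f f' : ℝ → ℂ} {c : ℂ} {m B : ℝ}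
    (hm : m ≤ 1) (hd : ∀ᶠ t in atTop, HasDerivAt f (f' t) t)
    (hB : ∀ᶠ t in atTop, ‖f t‖ ≤ B)
    (hlim : Tendsto (fun t : ℝ => ((t ^ m : ℝ) : ℂ) * f' t) atTop (𝓝 c)) : c = 0 := by
  by_contra hc
  have hpos : 0 < Complex.normSq c := Complex.normSq_pos.2 hc
  have hre : Tendsto (fun t : ℝ => (conj c * (((t ^ m : ℝ) : ℂ) * f' t)).re) atTop
      (𝓝 (Complex.normSq c)) := by
    have := (Complex.continuous_re.tendsto _).comp (hlim.const_mul (conj c))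
    rwa [← Complex.normSq_eq_conj_mul_self, Complex.ofReal_re] at this
  refine not_eventually_le_of_div_le_deriv (h := fun t => (conj c * f t).re)
    (h' := fun t => (conj c * f' t).re) (B := ‖c‖ * B) (half_pos hpos) ?_ ?_ ?_
  · filter_upwards [hd] with t ht
    exact Complex.reCLM.hasFDerivAt.comp_hasDerivAt t (ht.const_mul (conj c))
  · filter_upwards [hre.eventually_const_le (half_lt_self hpos), eventually_ge_atTop 1]
      with t ht ht1
    have ht0 : 0 < t := by linarith
    have hfac : (conj c * (((t ^ m : ℝ) : ℂ) * f' t)).re = t ^ m * (conj c * f' t).re := by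
      rw [mul_left_comm, Complex.re_ofReal_mul]
    rw [hfac] at ht
    have hnonneg : 0 ≤ (conj c * f' t).re :=
      (pos_of_mul_pos_right ((half_pos hpos).trans_le ht) (Real.rpow_nonneg ht0.le m)).le
    have hle : t ^ m ≤ t := by
      simpa using Real.rpow_le_rpow_of_exponent_le ht1 hm
    rw [div_le_iff₀ ht0, mul_comm _ t]
    exact ht.trans (mul_le_mul_of_nonneg_right hle hnonneg)
  · filter_upwards [hB] with t ht
    calc (conj c * f t).re ≤ ‖conj c * f t‖ := Complex.re_le_norm _
      _ = ‖c‖ * ‖f t‖ := by rw [norm_mul, Complex.norm_conj]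
      _ ≤ ‖c‖ * B := by gcongr

open Filter Topology in
/-- A combination of distinct powers `t ^ (-ν i)` is asymptotic to its term with the smallest
exponent `ν i` among those with nonzero coefficient. -/
theorem tendsto_rpow_mul_sum_rpow_neg {ι : Type*} [Fintype ι] {ν : ι → ℝ}
    (hinj : Function.Injective ν) (c : ι → ℂ) (j : ι)
    (hj : ∀ i, c i ≠ 0 → ν j ≤ ν i) :
    Tendsto (fun t : ℝ => ((t ^ ν j : ℝ) : ℂ) * ∑ i, c i * ((t ^ (-ν i) : ℝ) : ℂ)) atTop
      (𝓝 (c j)) := by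
  classical
  have hsum : Tendsto (fun t : ℝ => ∑ i, c i * ((t ^ (-(ν i - ν j)) : ℝ) : ℂ)) atTop
      (𝓝 (∑ i, if i = j then c j else 0)) := by
    refine tendsto_finsetSum _ fun i _ => ?_
    split_ifs with hij
    · subst hij
      simp
    · by_cases hci : c i = 0
      · simp [hci]
      · have hlt : 0 < ν i - ν j :=
          sub_pos.2 ((hj i hci).lt_of_ne fun h => hij (hinj h.symm))
        have := (Complex.continuous_ofReal.tendsto _).comp (tendsto_rpow_neg_atTop hlt)
        simpa using this.const_mul (c i)
  rw [Finset.sum_ite_eq' Finset.univ j, if_pos (Finset.mem_univ j)] at hsum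
  refine hsum.congr' ?_
  filter_upwards [eventually_gt_atTop 0] with t ht
  rw [Finset.mul_sum]
  refine Finset.sum_congr rfl fun i _ => ?_
  rw [mul_left_comm, ← Complex.ofReal_mul, ← Real.rpow_add ht, neg_sub, sub_eq_add_neg]

theorem linear_independence_in_Linfty_H1 (n : ℕ) (hn : 1 ≤ n)
    (ν : Fin n → ℝ) (hinj : Function.Injective ν)
    (hν : ∀ i, 0 ≤ ν i ∧ ν i ≤ 1) (c : Fin n → ℂ) (f : ℝ → ℂ)
    (hf : ∀ t ∈ Set.Ioi (1 : ℝ),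
      HasDerivAt f (∑ i, c i * ((t ^ (-ν i) : ℝ) : ℂ)) t)
    (hbd : ∃ B : ℝ, ∀ t ∈ Set.Ioi (1 : ℝ), ‖f t‖ ≤ B) :
    ∀ i, c i = 0 := by
  obtain ⟨B, hB⟩ := hbd
  by_contra! hne
  obtain ⟨k, hk⟩ := hne
  obtain ⟨j, hj, hmin⟩ := (Finset.univ.filter fun i => c i ≠ 0).exists_min_image ν
    ⟨k, by simpa using hk⟩
  refine (Finset.mem_filter.1 hj).2 (eq_zero_of_tendsto_rpow_mul_deriv_of_bounded (hν j).2
    ((Filter.eventually_gt_atTop 1).mono hf) ((Filter.eventually_gt_atTop 1).mono hB)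
    (tendsto_rpow_mul_sum_rpow_neg hinj c j fun i hi => hmin i (by simpa using hi)))
end
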